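/- Discrete stochastic Gronwall inequality: Let (Ω, F, {F_n}, P) be a filtered probability space, {M_n} an {F_n}-martingale with M₀ = 0, and {X_n}, {F_n}, {G_n} sequences of nonnegative adapted random variables with E[X₀] < ∞ satisfying X_n ≤ F_n + M_n + Σ_{ℓ=0}^{n−1} G_ℓ X_ℓ for all n ∈ ℕ. Then for any q ∈ (0,1) and conjugate exponents α, β ∈ [1, ∞] with 1/α + 1/β = 1 and qα < 1, one has E[sup_{0≤ℓ≤n} X_ℓ^q] ≤ (1 + 1/(1 − αq))^{1/α} · ‖∏_{ℓ=0}^{n−1} (1 + G_ℓ)^q‖_{L^β(Ω)} · (E[sup_{0≤ℓ≤n} F_ℓ])^q. -/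

import Mathlib

section SGAux
open MeasureTheory Finset

theorem sg_weak_moment {Ω : Type*} {m : MeasurableSpace Ω} {μ : Measure Ω} [IsProbabilityMeasure μ]
    (f : Ω → ℝ) (hf : Measurable f) (hf0 : ∀ ω, 0 ≤ f ω) (A p : ℝ) (hA : 0 ≤ A) (hp0 : 0 < p)
    (hp1 : p < 1) (h : ∀ t : ℝ, 0 < t → ENNReal.ofReal t * μ {ω | t ≤ f ω} ≤ ENNReal.ofReal A) :
    ∫⁻ ω, ENNReal.ofReal (f ω ^ p) ∂μ ≤ ENNReal.ofReal (A ^ p / (1 - p)) := by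
  have h' : ∀ t : ℝ, 0 < t → μ {ω | t ≤ f ω} ≤ ENNReal.ofReal (A / t) := by
    intro t ht
    rw [ENNReal.ofReal_div_of_pos ht]
    rw [ENNReal.le_div_iff_mul_le (by simp [ht]) (by simp), mul_comm]
    exact h t ht
  rw [lintegral_rpow_eq_lintegral_meas_le_mul μ (ae_of_all _ hf0) hf.aemeasurable hp0]
  rcases hA.eq_or_lt with rfl | hA
  · have : ∫⁻ t in Set.Ioi (0:ℝ), μ {a : Ω | t ≤ f a} * ENNReal.ofReal (t ^ (p - 1)) = 0 := by
      rw [setLIntegral_congr_fun (g := fun _ => 0) measurableSet_Ioi]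
      · simp
      · intro t ht
        have := h' t ht
        simp only [zero_div, ENNReal.ofReal_zero, nonpos_iff_eq_zero] at this
        simp [this]
    rw [this]; simp
  · have hsplit : Set.Ioi (0:ℝ) = Set.Ioc 0 A ∪ Set.Ioi A := (Set.Ioc_union_Ioi_eq_Ioi hA.le).symm
    have e1 : ∫⁻ t in Set.Ioc 0 A, μ {a : Ω | t ≤ f a} * ENNReal.ofReal (t ^ (p - 1))
        ≤ ENNReal.ofReal (A ^ p / p) := by
      calc _ ≤ ∫⁻ t in Set.Ioc 0 A, ENNReal.ofReal (t ^ (p - 1)) := by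
            apply lintegral_mono
            intro t
            calc _ ≤ 1 * ENNReal.ofReal (t ^ (p - 1)) := mul_le_mul_left prob_le_one _
              _ = _ := one_mul _
        _ = ENNReal.ofReal (∫ t in Set.Ioc 0 A, t ^ (p - 1)) := by
            rw [ofReal_integral_eq_lintegral_ofReal]
            · exact (intervalIntegrable_iff_integrableOn_Ioc_of_le hA.le).1
                (intervalIntegral.intervalIntegrable_rpow' (by linarith))
            · filter_upwards [ae_restrict_mem measurableSet_Ioc] with t ht
              exact Real.rpow_nonneg ht.1.le _
        _ ≤ _ := by
            rw [← intervalIntegral.integral_of_le hA.le, integral_rpow (Or.inl (by linarith))]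
            simp [Real.zero_rpow hp0.ne']
    have e2 : ∫⁻ t in Set.Ioi A, μ {a : Ω | t ≤ f a} * ENNReal.ofReal (t ^ (p - 1))
        ≤ ENNReal.ofReal (A ^ p / (1 - p)) := by
      calc _ ≤ ∫⁻ t in Set.Ioi A, ENNReal.ofReal (A * t ^ (p - 2)) := by
            apply setLIntegral_mono' measurableSet_Ioi
            intro t ht
            have ht0 : 0 < t := hA.trans ht
            calc _ ≤ ENNReal.ofReal (A / t) * ENNReal.ofReal (t ^ (p - 1)) := by
                  gcongr; exact h' t ht0
              _ = _ := by
                  rw [← ENNReal.ofReal_mul (by positivity)]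
                  congr 1
                  rw [show p - 1 = (p - 2) + 1 by ring, Real.rpow_add_one ht0.ne']
                  field_simp
        _ = ENNReal.ofReal (∫ t in Set.Ioi A, A * t ^ (p - 2)) := by
            rw [ofReal_integral_eq_lintegral_ofReal]
            · exact (integrableOn_Ioi_rpow_of_lt (by linarith) hA).const_mul _
            · filter_upwards [ae_restrict_mem measurableSet_Ioi] with t ht
              exact mul_nonneg hA.le (Real.rpow_nonneg (hA.trans ht).le _)
        _ ≤ _ := by
            rw [integral_const_mul, integral_Ioi_rpow_of_lt (by linarith) hA]
            apply ENNReal.ofReal_le_ofReal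
            apply le_of_eq
            have : A ^ p = A ^ (p - 2 + 1) * A := by
              rw [← Real.rpow_add_one hA.ne']; congr 1; ring
            rw [this]
            have h1 : p - 2 + 1 ≠ 0 := by linarith
            have h2 : 1 - p ≠ 0 := by linarith
            have h3 : 1 - p = - (p - 2 + 1) := by ring
            rw [h3, neg_div, div_neg]
            ring
    rw [hsplit, lintegral_union measurableSet_Ioi (Set.Ioc_disjoint_Ioi le_rfl)]
    calc _ ≤ ENNReal.ofReal p * (ENNReal.ofReal (A ^ p / p) + ENNReal.ofReal (A ^ p / (1 - p))) := by
          gcongr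
      _ ≤ _ := by
          have : 0 < 1 - p := by linarith
          rw [← ENNReal.ofReal_add (by positivity) (by positivity), ← ENNReal.ofReal_mul hp0.le]
          apply ENNReal.ofReal_le_ofReal
          apply le_of_eq
          field_simp
          ring

theorem sg_maximal {Ω : Type*} {m : MeasurableSpace Ω} {μ : Measure Ω} [IsProbabilityMeasure μ]
    (ℱ : Filtration ℕ m) (L : ℕ → Ω → ℝ) (hL : Submartingale L ℱ μ) (n : ℕ)
    (hL0 : ∫ ω, L n ω ∂μ ≤ 0) (H : Ω → ℝ) (hH : Integrable H μ) (hH0 : ∀ ω, 0 ≤ H ω)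
    (hLH : ∀ ω, - H ω ≤ L n ω) (t : ℝ) (ht : 0 < t) :
    ENNReal.ofReal t * μ {ω | t ≤ (range (n + 1)).sup' nonempty_range_add_one fun k => (L k ω)⁺}
      ≤ ENNReal.ofReal (∫ ω, H ω ∂μ) := by
  have h1 := maximal_ineq hL.pos (fun k ω => posPart_nonneg _) (ε := ⟨t, ht.le⟩) n
  have hi : Integrable (fun ω => (L n ω)⁺) μ := hL.pos.integrable n
  have h2 : ∀ s, ∫ ω in s, (L n ω)⁺ ∂μ ≤ ∫ ω, H ω ∂μ := by
    intro s
    calc _ ≤ ∫ ω, (L n ω)⁺ ∂μ := setIntegral_le_integral hi (ae_of_all _ fun ω => posPart_nonneg _)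
      _ ≤ ∫ ω, (L n ω + H ω) ∂μ := by
          apply integral_mono hi ((hL.integrable n).add hH)
          intro ω
          have := hLH ω; have := hH0 ω
          change (L n ω)⁺ ≤ L n ω + H ω
          simp only [posPart_def]
          apply sup_le <;> linarith
      _ ≤ _ := by
          rw [integral_add (hL.integrable n) hH]; linarith
  rw [ENNReal.ofReal_eq_coe_nnreal ht.le]
  refine le_trans h1 ?_
  exact ENNReal.ofReal_le_ofReal (h2 _)

theorem sg_jensen {Ω : Type*} {m : MeasurableSpace Ω} {μ : Measure Ω} [IsProbabilityMeasure μ]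
    (f : Ω → ℝ) (hf : Measurable f) (hf0 : ∀ ω, 0 ≤ f ω) (p : ℝ) (hp0 : 0 < p) (hp1 : p ≤ 1) :
    ∫⁻ ω, ENNReal.ofReal (f ω ^ p) ∂μ ≤ (∫⁻ ω, ENNReal.ofReal (f ω) ∂μ) ^ p := by
  have := eLpNorm'_le_eLpNorm'_of_exponent_le hp0 hp1 μ hf.aestronglyMeasurable
  simp only [eLpNorm'_eq_lintegral_enorm, ENNReal.rpow_one, div_one] at this
  have h2 := ENNReal.rpow_le_rpow this hp0.le
  rw [← ENNReal.rpow_mul, one_div_mul_cancel hp0.ne', ENNReal.rpow_one] at h2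
  simpa [Real.enorm_of_nonneg (hf0 _), ENNReal.ofReal_rpow_of_nonneg (hf0 _) hp0.le] using h2

end SGAux

open MeasureTheory Finset in
/-- Discrete stochastic Gronwall inequality (Kruse–Scheutzow): if `X_n ≤ F_n + M_n +
∑_{ℓ<n} G_ℓ X_ℓ` with `M` a martingale started at `0` and `X, F, G` nonnegative adapted,
then for `q ∈ (0,1)` and conjugate `α, β ∈ [1,∞]` with `qα < 1`,
`E[sup_{ℓ≤n} X_ℓ^q] ≤ (1 + 1/(1−αq))^{1/α} ‖∏_{ℓ<n}(1+G_ℓ)^q‖_{L^β} (E[sup_{ℓ≤n} F_ℓ])^q`. -/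
theorem discrete_stochastic_gronwall
    {Ω : Type*} {m : MeasurableSpace Ω} {μ : Measure Ω} [IsProbabilityMeasure μ]
    (ℱ : Filtration ℕ m) (M X F G : ℕ → Ω → ℝ)
    (hM : Martingale M ℱ μ) (hM0 : ∀ ω, M 0 ω = 0)
    (hXadap : Adapted ℱ X) (hFadap : Adapted ℱ F) (hGadap : Adapted ℱ G)
    (hXpos : ∀ n ω, 0 ≤ X n ω) (hFpos : ∀ n ω, 0 ≤ F n ω) (hGpos : ∀ n ω, 0 ≤ G n ω)
    (hX0 : Integrable (X 0) μ)
    (hrec : ∀ n ω, X n ω ≤ F n ω + M n ω + ∑ ℓ ∈ Finset.range n, G ℓ ω * X ℓ ω)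
    (q α : ℝ) (β : ENNReal) (hq0 : 0 < q) (hq1 : q < 1) (hα : 1 ≤ α) (hβ : 1 ≤ β)
    (hconj : 1 / α + 1 / β.toReal = 1) (hqα : q * α < 1) (n : ℕ) :
    ∫⁻ ω, ENNReal.ofReal (⨆ ℓ : Fin (n + 1), X ℓ ω ^ q) ∂μ ≤
      ENNReal.ofReal ((1 + 1 / (1 - α * q)) ^ (1 / α)) *
        eLpNorm (fun ω => ∏ ℓ ∈ Finset.range n, (1 + G ℓ ω) ^ q) β μ *
        (∫⁻ ω, ENNReal.ofReal (⨆ ℓ : Fin (n + 1), F ℓ ω) ∂μ) ^ q := by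
  set P : ℕ → Ω → ℝ := fun k ω => ∏ ℓ ∈ Finset.range k, (1 + G ℓ ω) with hP
  set D : ℕ → Ω → ℝ := fun k ω => (P k ω)⁻¹ with hD
  set Fs : ℕ → Ω → ℝ := fun k ω => partialSups (fun i => F i ω) k with hFs
  set L : ℕ → Ω → ℝ := fun k => ∑ j ∈ Finset.range k, D (j + 1) * (M (j + 1) - M j) with hLdef
  set W : Ω → ℝ := fun ω =>
    (range (n + 1)).sup' nonempty_range_add_one fun k => (L k ω)⁺ with hW
  have hP1 : ∀ k ω, 1 ≤ P k ω := by
    intro k ω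
    induction k with
    | zero => simp [hP]
    | succ k ih =>
      have h2 := hGpos k ω
      simp only [hP, Finset.prod_range_succ] at ih ⊢
      nlinarith
  have hPpos : ∀ k ω, 0 < P k ω := fun k ω => lt_of_lt_of_le one_pos (hP1 k ω)
  have hPmono : ∀ ω, Monotone fun k => P k ω := by
    intro ω
    apply monotone_nat_of_le_succ
    intro k
    simp only [hP, Finset.prod_range_succ]
    have h1 := hPpos k ω
    have h2 := hGpos k ω
    simp only [hP] at h1
    nlinarith
  have hDpos : ∀ k ω, 0 < D k ω := fun k ω => inv_pos.2 (hPpos k ω)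
  have hD1 : ∀ k ω, D k ω ≤ 1 := fun k ω => inv_le_one_of_one_le₀ (hP1 k ω)
  have hGm : ∀ k, Measurable (G k) := fun k => (hGadap k).mono (ℱ.le k) le_rfl
  have hFm : ∀ k, Measurable (F k) := fun k => (hFadap k).mono (ℱ.le k) le_rfl
  have hDad : StronglyAdapted ℱ fun k => D (k + 1) := by
    intro k
    apply Measurable.stronglyMeasurable
    apply Measurable.inv
    apply Finset.measurable_fun_prod
    intro i hi
    exact measurable_const.add
      ((hGadap i).mono (ℱ.mono (by simp at hi; omega)) le_rfl)
  have hLsub : Submartingale L ℱ μ :=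
    hM.submartingale.sum_mul_sub' hDad hD1 (fun k ω => (hDpos k ω).le)
  have hLneg : ∫ ω, L n ω ∂μ ≤ 0 := by
    have h1 : Submartingale (fun k => ∑ j ∈ Finset.range k, D (j + 1) * ((-M) (j + 1) - (-M) j)) ℱ μ :=
      hM.neg.submartingale.sum_mul_sub' hDad hD1 (fun k ω => (hDpos k ω).le)
    have h2 := h1.setIntegral_le (Nat.zero_le n) MeasurableSet.univ
    simp only [Finset.range_zero, Finset.sum_empty, Measure.restrict_univ] at h2
    have h3 : (∑ j ∈ Finset.range n, D (j + 1) * ((-M) (j + 1) - (-M) j)) = - L n := by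
      simp only [hLdef, ← Finset.sum_neg_distrib]
      apply Finset.sum_congr rfl
      intro j _
      simp only [Pi.neg_apply]
      ring
    rw [h3] at h2
    simp only [Pi.neg_apply, integral_neg, Pi.zero_apply, integral_zero] at h2
    linarith
  have hFle : ∀ k ω, F k ω ≤ Fs k ω := fun k ω => le_partialSups (fun i => F i ω) k
  have hFs0 : ∀ k ω, 0 ≤ Fs k ω := fun k ω => (hFpos k ω).trans (hFle k ω)
  have hFsmono : ∀ ω, Monotone fun k => Fs k ω := fun ω => (partialSups (fun i => F i ω)).monotone
  have hFsm : Measurable (Fs n) := by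
    have : Fs n = fun ω => (range (n + 1)).sup' nonempty_range_add_one fun k => F k ω := by
      funext ω
      simp only [hFs, partialSups_eq_sup'_range]
    rw [this]
    exact Finset.measurable_range_sup'' fun k _ => hFm k
  have hLm : ∀ k, Measurable (L k) := fun k =>
    ((hLsub.stronglyAdapted k).mono (ℱ.le k)).measurable
  have hWm : Measurable W := Finset.measurable_range_sup'' fun k _ => (hLm k).sup measurable_const
  have hW0 : ∀ ω, 0 ≤ W ω := fun ω =>
    (posPart_nonneg (L 0 ω)).trans
      (Finset.le_sup' (fun k => (L k ω)⁺) (Finset.mem_range.2 (Nat.succ_pos n)))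
  have hLW : ∀ k ≤ n, ∀ ω, L k ω ≤ W ω := fun k hk ω =>
    (le_posPart (L k ω)).trans
      (Finset.le_sup' (fun k => (L k ω)⁺) (Finset.mem_range.2 (Nat.lt_succ_of_le hk)))
  have hXZ : ∀ k ω, X k ω ≤ Fs k ω + M k ω + ∑ ℓ ∈ Finset.range k, G ℓ ω * X ℓ ω := fun k ω => by
    have := hrec k ω; have := hFle k ω; linarith
  have key : ∀ k ω, D k ω * (Fs k ω + M k ω + ∑ ℓ ∈ Finset.range k, G ℓ ω * X ℓ ω)
      ≤ Fs k ω + L k ω := by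
    intro k ω
    induction k with
    | zero => simp [hD, hP, hLdef, hM0]
    | succ k ih =>
      have hL1 : L (k + 1) ω = L k ω + D (k + 1) ω * (M (k + 1) ω - M k ω) := by
        simp [hLdef, Finset.sum_range_succ]
      have hDk : D k ω = D (k + 1) ω * (1 + G k ω) := by
        have h1 := (hPpos k ω).ne'
        have h2 : (1 + G k ω) ≠ 0 := by have := hGpos k ω; positivity
        have h3 : P (k + 1) ω = P k ω * (1 + G k ω) := by simp only [hP, Finset.prod_range_succ]
        simp only [hD, h3]
        field_simp
      rw [hL1, Finset.sum_range_succ]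
      rw [hDk] at ih
      have hx := hXZ k ω
      have hF : Fs k ω ≤ Fs (k + 1) ω := hFsmono ω (Nat.le_succ k)
      have hg := hGpos k ω
      have hd := hDpos (k + 1) ω
      have hd1 := hD1 (k + 1) ω
      generalize (∑ ℓ ∈ Finset.range k, G ℓ ω * X ℓ ω) = S at *
      generalize D (k + 1) ω = d at *
      have a1 : d * (G k ω * X k ω) ≤ d * (G k ω * (Fs k ω + M k ω + S)) := by gcongr
      have a2 : d * (Fs (k + 1) ω - Fs k ω) ≤ 1 * (Fs (k + 1) ω - Fs k ω) :=
        mul_le_mul_of_nonneg_right hd1 (by linarith)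
      nlinarith
  have hLH : ∀ ω, - Fs n ω ≤ L n ω := fun ω => by
    have h1 := key n ω
    have h2 := mul_nonneg (hDpos n ω).le ((hXpos n ω).trans (hXZ n ω))
    linarith
  have hXW : ∀ k ≤ n, ∀ ω, X k ω ≤ P n ω * (Fs n ω + W ω) := by
    intro k hk ω
    have h1 : D k ω * X k ω ≤ Fs n ω + W ω := by
      have h2 := mul_le_mul_of_nonneg_left (hXZ k ω) (hDpos k ω).le
      have h3 := key k ω
      have h4 := hFsmono ω hk
      have h5 := hLW k hk ω
      simp only at h4
      linarith
    have h6 : X k ω = P k ω * (D k ω * X k ω) := by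
      have := (hPpos k ω).ne'
      simp only [hD]; field_simp
    rw [h6]
    exact mul_le_mul (hPmono ω hk) h1 (mul_nonneg (hDpos k ω).le (hXpos k ω)) (hPpos n ω).le
  have hFsI : ∀ ω, Fs n ω ≤ ⨆ ℓ : Fin (n + 1), F ℓ ω := by
    intro ω
    apply partialSups_le
    intro j hj
    exact le_ciSup (f := fun ℓ : Fin (n + 1) => F ℓ ω) (Set.finite_range _).bddAbove
      (⟨j, Nat.lt_succ_of_le hj⟩ : Fin (n + 1))
  have hα0 : 0 < α := by linarith
  have hβ' : β⁻¹ + (ENNReal.ofReal α)⁻¹ = 1 := by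
    rcases eq_or_ne β ⊤ with rfl | hb
    · simp at hconj
      simp [hconj]
    · have hb0 : 0 < β.toReal := ENNReal.toReal_pos (by rintro rfl; simp at hβ) hb
      rw [← ENNReal.ofReal_toReal hb, ← ENNReal.ofReal_inv_of_pos hb0,
        ← ENNReal.ofReal_inv_of_pos hα0, ← ENNReal.ofReal_add (by positivity) (by positivity)]
      rw [← ENNReal.ofReal_one]
      congr 1
      rw [← hconj]; simp [add_comm]
  set φ : Ω → ℝ := fun ω => ∏ ℓ ∈ Finset.range n, (1 + G ℓ ω) ^ q with hφ
  have hφP : ∀ ω, φ ω = P n ω ^ q := fun ω =>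
    Real.finsetProd_rpow _ _ (fun i _ => by have := hGpos i ω; positivity) q
  have hPm : Measurable (P n) := by
    apply Finset.measurable_fun_prod
    intro i _
    exact measurable_const.add (hGm i)
  have hφm : Measurable φ := by
    rw [funext hφP]
    exact hPm.pow_const q
  set B := ∫⁻ ω, ENNReal.ofReal (Fs n ω) ∂μ with hB
  set c : ℝ := 1 + 1 / (1 - α * q) with hc
  have hαq : 0 < 1 - α * q := by linarith
  have hc0 : 0 < c := by positivity
  have hBle : B ≤ ∫⁻ ω, ENNReal.ofReal (⨆ ℓ : Fin (n + 1), F ℓ ω) ∂μ :=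
    lintegral_mono fun ω => ENNReal.ofReal_le_ofReal (hFsI ω)
  have main : ∫⁻ ω, ENNReal.ofReal ((Fs n ω + W ω) ^ (q * α)) ∂μ
      ≤ ENNReal.ofReal c * B ^ (q * α) := by
    have hp0 : 0 < q * α := by positivity
    rcases eq_or_ne B ⊤ with hBt | hBt
    · rw [hBt, ENNReal.top_rpow_of_pos hp0, ENNReal.mul_top]
      · exact le_top
      · simpa using hc0
    have hFi : Integrable (Fs n) μ :=
      (lintegral_ofReal_ne_top_iff_integrable hFsm.aestronglyMeasurable (ae_of_all _ (hFs0 n))).1 hBt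
    have hBe : B = ENNReal.ofReal (∫ ω, Fs n ω ∂μ) :=
      (ofReal_integral_eq_lintegral_ofReal hFi (ae_of_all _ (hFs0 n))).symm
    have hA0 : 0 ≤ ∫ ω, Fs n ω ∂μ := integral_nonneg (hFs0 n)
    have e1 := sg_jensen (μ := μ) (Fs n) hFsm (hFs0 n) (q * α) hp0 hqα.le
    have e2 := sg_weak_moment (μ := μ) W hWm hW0 _ (q * α) hA0 hp0 hqα
      (fun t ht => sg_maximal ℱ L hLsub n hLneg (Fs n) hFi (hFs0 n) hLH t ht)
    rw [← hB] at e1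
    calc _ ≤ ∫⁻ ω, (ENNReal.ofReal (Fs n ω ^ (q * α)) + ENNReal.ofReal (W ω ^ (q * α))) ∂μ := by
          apply lintegral_mono
          intro ω
          simp only
          rw [← ENNReal.ofReal_add (Real.rpow_nonneg (hFs0 n ω) _) (Real.rpow_nonneg (hW0 ω) _)]
          exact ENNReal.ofReal_le_ofReal
            (Real.rpow_add_le_add_rpow (hFs0 n ω) (hW0 ω) hp0.le hqα.le)
      _ = _ := lintegral_add_left (hFsm.pow_const _).ennreal_ofReal _
      _ ≤ B ^ (q * α) + ENNReal.ofReal ((∫ ω, Fs n ω ∂μ) ^ (q * α) / (1 - q * α)) :=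
          add_le_add e1 e2
      _ = ENNReal.ofReal c * B ^ (q * α) := by
          have h1 : 0 < 1 - q * α := by linarith
          rw [hBe, ENNReal.ofReal_rpow_of_nonneg hA0 hp0.le,
            ← ENNReal.ofReal_add (by positivity) (by positivity), ← ENNReal.ofReal_mul hc0.le]
          congr 1
          rw [hc, mul_comm α q]
          ring
  set g : Ω → ℝ := fun ω => (Fs n ω + W ω) ^ q with hg
  have hgm : Measurable g := (hFsm.add hWm).pow_const q
  have hFW : ∀ ω, 0 ≤ Fs n ω + W ω := fun ω => add_nonneg (hFs0 n ω) (hW0 ω)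
  have hgn : eLpNorm g (ENNReal.ofReal α) μ ≤ ENNReal.ofReal (c ^ (1 / α)) * B ^ q := by
    rw [eLpNorm_eq_lintegral_rpow_enorm_toReal (by simpa using hα0) (by simp),
      ENNReal.toReal_ofReal hα0.le]
    have h1 : ∀ ω, ‖g ω‖ₑ ^ α = ENNReal.ofReal ((Fs n ω + W ω) ^ (q * α)) := by
      intro ω
      have h2 : 0 ≤ g ω := Real.rpow_nonneg (hFW ω) _
      rw [Real.enorm_of_nonneg h2, ENNReal.ofReal_rpow_of_nonneg h2 hα0.le]
      simp only [hg]
      rw [← Real.rpow_mul (hFW ω)]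
    simp only [h1]
    calc _ ≤ (ENNReal.ofReal c * B ^ (q * α)) ^ (1 / α) :=
          ENNReal.rpow_le_rpow main (by positivity)
      _ = _ := by
          rw [ENNReal.mul_rpow_of_nonneg _ _ (by positivity), ← ENNReal.rpow_mul,
            ENNReal.ofReal_rpow_of_nonneg hc0.le (by positivity)]
          congr 2
          field_simp
  have hold : eLpNorm (φ • g) 1 μ ≤ eLpNorm φ β μ * eLpNorm g (ENNReal.ofReal α) μ := by
    have : ENNReal.HolderTriple β (ENNReal.ofReal α) 1 := ⟨by simpa using hβ'⟩
    exact eLpNorm_smul_le_mul_eLpNorm hgm.aestronglyMeasurable hφm.aestronglyMeasurable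
  calc _ ≤ eLpNorm (φ • g) 1 μ := by
        rw [eLpNorm_one_eq_lintegral_enorm]
        apply lintegral_mono
        intro ω
        have h0 : (φ • g) ω = (P n ω * (Fs n ω + W ω)) ^ q := by
          simp only [Pi.smul_apply', smul_eq_mul, hφP, hg]
          rw [Real.mul_rpow (hPpos n ω).le (hFW ω)]
        simp only
        rw [h0, Real.enorm_of_nonneg
          (Real.rpow_nonneg (mul_nonneg (hPpos n ω).le (hFW ω)) _)]
        apply ENNReal.ofReal_le_ofReal
        apply ciSup_le
        intro ℓ
        exact Real.rpow_le_rpow (hXpos _ ω) (hXW ℓ (Nat.le_of_lt_succ ℓ.2) ω) hq0.le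
    _ ≤ _ := hold
    _ ≤ eLpNorm φ β μ * (ENNReal.ofReal (c ^ (1 / α)) * B ^ q) := by gcongr
    _ = ENNReal.ofReal (c ^ (1 / α)) * eLpNorm φ β μ * B ^ q := by ring
    _ ≤ _ := by gcongr
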